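/- Let d ≥ 2 and let α ∈ [1, ∞] with α ≠ 2. Every bijective map h : ℝ^d → ℝ^d satisfying ‖h(x) − h(y)‖_α = ‖x − y‖_α for all x, y ∈ ℝ^d has the form h(x) = b + Ux, where b ∈ ℝ^d and U is a generalized permutation matrix with unit scalars, i.e., there exist a permutation π of {1,…,d} and signs s_1,…,s_d ∈ {−1, +1} such that (Ux)_i = s_i · x_{π(i)}. -/

import Mathlib

theorem Real.rpow_add_rpow_lt_add_rpow {u v q : ℝ} (hu : 0 < u) (hv : 0 < v) (hq : 1 < q) :
    u ^ q + v ^ q < (u + v) ^ q := by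
  have split : ∀ {w : ℝ}, 0 < w → w ^ q = w * w ^ (q - 1) := fun {w} hw => by
    rw [← Real.rpow_one_add' hw.le (by linarith)]
    ring_nf
  have hq' : 0 < q - 1 := by linarith
  rw [split hu, split hv, split (add_pos hu hv), add_mul]
  gcongr <;> linarith

theorem Real.add_rpow_lt_rpow_add_rpow {u v q : ℝ} (hu : 0 < u) (hv : 0 < v)
    (hq₀ : 0 < q) (hq : q < 1) :
    (u + v) ^ q < u ^ q + v ^ q := by
  have split : ∀ {w : ℝ}, 0 < w → w ^ q = w * w ^ (q - 1) := fun {w} hw => by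
    rw [← Real.rpow_one_add' hw.le (by linarith)]
    ring_nf
  have hq' : q - 1 < 0 := by linarith
  rw [split hu, split hv, split (add_pos hu hv), add_mul]
  have h₁ := Real.rpow_lt_rpow_of_neg hu (show u < u + v by linarith) hq'
  have h₂ := Real.rpow_lt_rpow_of_neg hv (show v < u + v by linarith) hq'
  gcongr

theorem Real.abs_rpow_eq_sq_rpow_half (a p : ℝ) : |a| ^ p = (a ^ 2) ^ (p / 2) := by
  rw [← sq_abs, ← Real.rpow_natCast_mul (abs_nonneg a)]
  congr 1
  push_cast
  ring

/-- The strict scalar Clarkson inequality for exponents above `2`. -/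
theorem Real.two_mul_abs_rpow_add_lt {a b p : ℝ} (ha : a ≠ 0) (hb : b ≠ 0) (hp : 2 < p) :
    2 * (|a| ^ p + |b| ^ p) < |a + b| ^ p + |a - b| ^ p := by
  simp only [Real.abs_rpow_eq_sq_rpow_half]
  have hq : 1 < p / 2 := by linarith
  have hstrict := Real.rpow_add_rpow_lt_add_rpow (sq_pos_of_ne_zero ha) (sq_pos_of_ne_zero hb) hq
  have hconv := (convexOn_rpow hq.le).2 (sq_nonneg (a + b)) (sq_nonneg (a - b))
    (show (0 : ℝ) ≤ 1 / 2 by norm_num) (show (0 : ℝ) ≤ 1 / 2 by norm_num) (by norm_num)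
  simp only [smul_eq_mul] at hconv
  rw [show 1 / 2 * (a + b) ^ 2 + 1 / 2 * (a - b) ^ 2 = a ^ 2 + b ^ 2 by ring] at hconv
  linarith

/-- The strict scalar Clarkson inequality for exponents below `2`. -/
theorem Real.abs_rpow_add_lt_two_mul {a b p : ℝ} (ha : a ≠ 0) (hb : b ≠ 0)
    (hp₀ : 0 < p) (hp : p < 2) :
    |a + b| ^ p + |a - b| ^ p < 2 * (|a| ^ p + |b| ^ p) := by
  simp only [Real.abs_rpow_eq_sq_rpow_half]
  have hq₀ : 0 < p / 2 := by linarith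
  have hq : p / 2 < 1 := by linarith
  have hstrict :=
    Real.add_rpow_lt_rpow_add_rpow (sq_pos_of_ne_zero ha) (sq_pos_of_ne_zero hb) hq₀ hq
  have hconc := (Real.concaveOn_rpow hq₀.le hq.le).2 (sq_nonneg (a + b)) (sq_nonneg (a - b))
    (show (0 : ℝ) ≤ 1 / 2 by norm_num) (show (0 : ℝ) ≤ 1 / 2 by norm_num) (by norm_num)
  simp only [smul_eq_mul] at hconc
  rw [show 1 / 2 * (a + b) ^ 2 + 1 / 2 * (a - b) ^ 2 = a ^ 2 + b ^ 2 by ring] at hconc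
  linarith

theorem Real.abs_add_rpow_add_abs_sub_rpow_of_mul_eq_zero {a b p : ℝ} (hp : 0 < p)
    (hab : a * b = 0) : |a + b| ^ p + |a - b| ^ p = 2 * (|a| ^ p + |b| ^ p) := by
  rcases mul_eq_zero.1 hab with rfl | rfl <;> simp [Real.zero_rpow hp.ne'] <;> ring

/-- Vectors attaining equality in Clarkson's inequality have disjoint supports. -/
theorem Real.mul_eq_zero_of_sum_abs_rpow_eq {ι : Type*} [Fintype ι] {p : ℝ} (hp₀ : 0 < p)
    (hp : p ≠ 2) (x y : ι → ℝ)
    (hxy : ∑ i, (|x i + y i| ^ p + |x i - y i| ^ p) = ∑ i, 2 * (|x i| ^ p + |y i| ^ p)) (i : ι) :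
    x i * y i = 0 := by
  by_contra hi
  have hlt : ∀ j, x j * y j ≠ 0 → x j ≠ 0 ∧ y j ≠ 0 := fun j => mul_ne_zero_iff.1
  rcases hp.lt_or_gt with hp' | hp'
  · refine hxy.not_lt (Finset.sum_lt_sum (fun j _ => ?_) ⟨i, Finset.mem_univ i,
      Real.abs_rpow_add_lt_two_mul (hlt i hi).1 (hlt i hi).2 hp₀ hp'⟩)
    by_cases hj : x j * y j = 0
    · exact (Real.abs_add_rpow_add_abs_sub_rpow_of_mul_eq_zero hp₀ hj).le
    · exact (Real.abs_rpow_add_lt_two_mul (hlt j hj).1 (hlt j hj).2 hp₀ hp').le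
  · refine hxy.not_gt (Finset.sum_lt_sum (fun j _ => ?_) ⟨i, Finset.mem_univ i,
      Real.two_mul_abs_rpow_add_lt (hlt i hi).1 (hlt i hi).2 hp'⟩)
    by_cases hj : x j * y j = 0
    · exact (Real.abs_add_rpow_add_abs_sub_rpow_of_mul_eq_zero hp₀ hj).ge
    · exact (Real.two_mul_abs_rpow_add_lt (hlt j hj).1 (hlt j hj).2 hp').le

/-- A square matrix without zero columns whose columns have pairwise disjoint supports is
supported on the graph of a permutation. -/
theorem Matrix.exists_perm_of_disjoint_columns {ι R : Type*} [Finite ι] [MulZeroClass R]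
    [NoZeroDivisors R] (A : Matrix ι ι R) (hne : ∀ j, ∃ i, A i j ≠ 0)
    (hdisj : ∀ i j k, j ≠ k → A i j * A i k = 0) :
    ∃ π : Equiv.Perm ι, ∀ i j, j ≠ π i → A i j = 0 := by
  choose σ hσ using hne
  have hinj : Function.Injective σ := fun j k hjk => by
    by_contra hne
    exact mul_ne_zero (hσ j) (hjk ▸ hσ k) (hdisj (σ j) j k hne)
  let e := Equiv.ofBijective σ (Finite.injective_iff_bijective.1 hinj)
  refine ⟨e.symm, fun i j hj => ?_⟩
  have hi : A i (e.symm i) ≠ 0 := by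
    have h := hσ (e.symm i)
    rwa [show σ (e.symm i) = i from e.apply_symm_apply i] at h
  exact (mul_eq_zero.1 (hdisj i j (e.symm i) hj)).resolve_right hi

namespace LinearIsometry

variable {ι : Type*} [Fintype ι] [DecidableEq ι] {p : ENNReal} [Fact (1 ≤ p)]

theorem piLp_single_mul_single_eq_zero_of_ne_top (hp : p ≠ 2) (hp_top : p ≠ ⊤)
    (U : PiLp p (fun _ : ι => ℝ) →ₗᵢ[ℝ] PiLp p (fun _ : ι => ℝ)) {j k : ι} (hjk : j ≠ k) (i : ι) :
    U (PiLp.single p j 1) i * U (PiLp.single p k 1) i = 0 := by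
  have hp₀ : 0 < p.toReal := ENNReal.toReal_pos (zero_lt_one.trans_le Fact.out).ne' hp_top
  have hp₂ : p.toReal ≠ 2 := fun h => hp <| by
    rw [← ENNReal.ofReal_toReal hp_top, h]
    simp
  have hnorm : ∀ x : PiLp p (fun _ : ι => ℝ),
      ∑ i, |U x i| ^ p.toReal = ∑ i, |x i| ^ p.toReal := fun x => by
    have hx := U.norm_map x
    rw [PiLp.norm_eq_sum hp₀, PiLp.norm_eq_sum hp₀] at hx
    exact (Real.rpow_left_inj (Finset.sum_nonneg fun _ _ => by positivity)
      (Finset.sum_nonneg fun _ _ => by positivity) (one_div_pos.2 hp₀).ne').1 hx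
  refine Real.mul_eq_zero_of_sum_abs_rpow_eq hp₀ hp₂ (U (PiLp.single p j 1))
    (U (PiLp.single p k 1)) ?_ i
  have hadd := hnorm (PiLp.single p j 1 + PiLp.single p k 1)
  have hsub := hnorm (PiLp.single p j 1 - PiLp.single p k 1)
  simp only [map_add, map_sub, PiLp.add_apply, PiLp.sub_apply] at hadd hsub
  rw [Finset.sum_add_distrib, ← Finset.mul_sum, Finset.sum_add_distrib, hadd, hsub, hnorm, hnorm,
    ← Finset.sum_add_distrib, ← Finset.sum_add_distrib, Finset.mul_sum]
  refine Finset.sum_congr rfl fun l _ =>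
    Real.abs_add_rpow_add_abs_sub_rpow_of_mul_eq_zero hp₀ ?_
  by_cases hl : l = j
  · simp [hl, hjk]
  · simp [hl]

theorem piLp_top_single_mul_single_eq_zero
    (U : PiLp ⊤ (fun _ : ι => ℝ) →ₗᵢ[ℝ] PiLp ⊤ (fun _ : ι => ℝ)) {j k : ι} (hjk : j ≠ k) (i : ι) :
    U (PiLp.single ⊤ j 1) i * U (PiLp.single ⊤ k 1) i = 0 := by
  have hle : ∀ i j k, j ≠ k →
      |U (PiLp.single ⊤ j 1) i| + |U (PiLp.single ⊤ k 1) i| ≤ 1 := fun i j k hjk => by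
    have : Nonempty ι := ⟨j⟩
    have hadd : ‖(PiLp.single ⊤ j 1 + PiLp.single ⊤ k 1 : PiLp ⊤ fun _ : ι => ℝ)‖ ≤ 1 := by
      refine ciSup_le fun l => ?_
      by_cases hl : l = j
      · simp [hl, hjk]
      · by_cases hl' : l = k <;> simp [hl, hl', hjk.symm]
    have hsub : ‖(PiLp.single ⊤ j 1 - PiLp.single ⊤ k 1 : PiLp ⊤ fun _ : ι => ℝ)‖ ≤ 1 := by
      refine ciSup_le fun l => ?_
      by_cases hl : l = j
      · simp [hl, hjk]
      · by_cases hl' : l = k <;> simp [hl, hl', hjk.symm]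
    have h₁ := (PiLp.norm_apply_le (U (PiLp.single ⊤ j 1 + PiLp.single ⊤ k 1)) i).trans
      ((U.norm_map _).trans_le hadd)
    have h₂ := (PiLp.norm_apply_le (U (PiLp.single ⊤ j 1 - PiLp.single ⊤ k 1)) i).trans
      ((U.norm_map _).trans_le hsub)
    simp only [map_add, map_sub, PiLp.add_apply, PiLp.sub_apply, Real.norm_eq_abs] at h₁ h₂
    rw [abs_le] at h₁ h₂
    rcases abs_cases (U (PiLp.single ⊤ j 1) i) with h | h <;>
      rcases abs_cases (U (PiLp.single ⊤ k 1) i) with h' | h' <;> linarith [h₁.1, h₁.2, h₂.1, h₂.2]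
  have hmax : ∀ j, ∃ i, |U (PiLp.single ⊤ j 1) i| = 1 := fun j => by
    have : Nonempty ι := ⟨j⟩
    obtain ⟨i, hi⟩ := exists_eq_ciSup_of_finite (f := fun i => ‖U (PiLp.single ⊤ j 1) i‖)
    refine ⟨i, ?_⟩
    rw [← Real.norm_eq_abs, hi, ← PiLp.norm_eq_ciSup, U.norm_map]
    simp
  choose σ hσ using hmax
  have hzero : ∀ j k, j ≠ k → U (PiLp.single ⊤ k 1) (σ j) = 0 := fun j k hjk => by
    have h := hle (σ j) j k hjk
    rw [hσ] at h
    exact abs_nonpos_iff.1 (by linarith)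
  have hinj : Function.Injective σ := fun j k hjk => by
    by_contra hne
    have h := hσ k
    rw [← hjk, hzero j k hne] at h
    simp at h
  obtain ⟨l, rfl⟩ := Finite.injective_iff_surjective.1 hinj i
  by_cases hl : l = j
  · rw [hzero l k (hl ▸ hjk), mul_zero]
  · rw [hzero l j hl, zero_mul]

/-- A linear isometry of a finite-dimensional real `ℓ^p` space, `p ≠ 2`, is a signed
permutation of the coordinates. -/
theorem piLp_exists_perm_sign (hp : p ≠ 2)
    (U : PiLp p (fun _ : ι => ℝ) →ₗᵢ[ℝ] PiLp p (fun _ : ι => ℝ)) :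
    ∃ (π : Equiv.Perm ι) (s : ι → ℝ), (∀ i, s i = 1 ∨ s i = -1) ∧
      ∀ x i, U x i = s i * x (π i) := by
  let A : Matrix ι ι ℝ := fun i j => U (PiLp.single p j 1) i
  have hnorm : ∀ j, ‖U (PiLp.single p j 1)‖ = 1 := fun j => by simp
  obtain ⟨π, hπ⟩ := A.exists_perm_of_disjoint_columns
    (fun j => by
      by_contra! h
      have : U (PiLp.single p j 1) = 0 := PiLp.ext h
      simpa [this] using hnorm j)
    (fun i j k hjk => by
      rcases eq_or_ne p ⊤ with rfl | hp_top
      · exact piLp_top_single_mul_single_eq_zero U hjk i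
      · exact piLp_single_mul_single_eq_zero_of_ne_top hp hp_top U hjk i)
  refine ⟨π, fun i => A i (π i), fun i => ?_, fun x i => ?_⟩
  · have hcol : U (PiLp.single p (π i) 1) = PiLp.single p i (A i (π i)) := by
      ext l
      by_cases hl : l = i
      · simp [hl, A]
      · simpa [hl] using hπ l (π i) fun h => hl (π.injective h).symm
    have h := hnorm (π i)
    rw [hcol, PiLp.norm_single, Real.norm_eq_abs] at h
    exact eq_or_eq_neg_of_abs_eq h
  · have hx : x = ∑ j, x j • PiLp.single p j (1 : ℝ) := by
      ext l
      simp [Pi.single_apply]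
    have hUx : U x i = ∑ j, x j * A i j := by
      conv_lhs => rw [hx]
      simp [A]
    rw [hUx, Finset.sum_eq_single (π i) (fun j _ hj => by rw [hπ i j hj, mul_zero]) (by simp),
      mul_comm]

end LinearIsometry

/-- Every bijective `ℓ_α`-isometry of `ℝ^d` (`d ≥ 2`, `α ∈ [1,∞]`, `α ≠ 2`) is of
the form `h(x) = b + U x` where `U` is a generalized permutation matrix with
unit (±1) scalars. -/
theorem lp_bijective_isometry_eq_translation_signed_perm
    (d : ℕ) (hd : 2 ≤ d) (α : ENNReal) [Fact (1 ≤ α)] (hα : α ≠ 2)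
    (h : (Fin d → ℝ) → (Fin d → ℝ)) (hbij : Function.Bijective h)
    (hiso : ∀ x y : Fin d → ℝ,
      ‖(WithLp.equiv α (Fin d → ℝ)).symm (h x - h y)‖ =
        ‖(WithLp.equiv α (Fin d → ℝ)).symm (x - y)‖) :
    ∃ (b : Fin d → ℝ) (π : Equiv.Perm (Fin d)) (s : Fin d → ℝ),
      (∀ i, s i = 1 ∨ s i = -1) ∧
        ∀ (x : Fin d → ℝ) (i : Fin d), h x i = b i + s i * x (π i) := by
  let e := WithLp.equiv α (Fin d → ℝ)
  let f : PiLp α (fun _ : Fin d => ℝ) ≃ᵢ PiLp α (fun _ : Fin d => ℝ) :=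
    { toEquiv := e.trans ((Equiv.ofBijective h hbij).trans e.symm)
      isometry_toFun := Isometry.of_dist_eq fun x y => by
        rw [dist_eq_norm, dist_eq_norm]
        exact hiso (e x) (e y) }
  obtain ⟨π, s, hs, hU⟩ :=
    LinearIsometry.piLp_exists_perm_sign hα f.toRealLinearIsometryEquiv.toLinearIsometry
  refine ⟨h 0, π, s, hs, fun x i => ?_⟩
  have hx : h x i - h 0 i = s i * x (π i) := by
    rw [← show (e.symm x : PiLp α fun _ : Fin d => ℝ) (π i) = x (π i) from rfl, ← hU]
    simp [f, e]
  linarith
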